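/- arXiv:1010.4064 — 15 statements merged into one kernel-verified Lean document; each statement's English description precedes it below -/
import Mathlib

section
/- Suppose K₀ ≠ 0, s > 0, σ > 0, and (λ_j)_{j≥1} are positive reals, (K_j)_{j≥1} are reals, and real sequences (ψ_j)_{j≥0}, (ξ_j)_{j≥0} satisfy ξ₀ = ψ₀ + K₀ s, ψ₀ = ξ₀ − K₀ σ, and for every j ≥ 1 both ξ_j = (ψ_j − K_j/λ_j) e^{−λ_j s} + K_j/λ_j and ψ_j = (ξ_j + K_j/λ_j) e^{−λ_j σ} − K_j/λ_j. Then s = σ and ξ_j = −ψ_j for every j ≥ 1. (This is the Fourier-coefficient form of the statement that every (s,σ)-periodic solution of the thermocontrol problem satisfies s = σ and is symmetric.) -/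
/-- Every (s,σ)-periodic solution satisfies s = σ and is symmetric
(Fourier-coefficient form). -/
theorem symmetric_periodic
    (K₀ s σ : ℝ) (lam K ψ ξ : ℕ → ℝ)
    (hK₀ : K₀ ≠ 0) (hs : 0 < s) (hσ : 0 < σ)
    (hlam : ∀ j, 1 ≤ j → 0 < lam j)
    (h1 : ξ 0 = ψ 0 + K₀ * s)
    (h2 : ψ 0 = ξ 0 - K₀ * σ)
    (h3 : ∀ j, 1 ≤ j →
      ξ j = (ψ j - K j / lam j) * Real.exp (-lam j * s) + K j / lam j)
    (h4 : ∀ j, 1 ≤ j →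
      ψ j = (ξ j + K j / lam j) * Real.exp (-lam j * σ) - K j / lam j) :
    s = σ ∧ ∀ j, 1 ≤ j → ξ j = -ψ j := by
  have hsσ : s = σ := mul_left_cancel₀ hK₀ (by linarith)
  subst hsσ
  refine ⟨rfl, fun j hj => ?_⟩
  have hexp : Real.exp (-lam j * s) < 1 :=
    Real.exp_lt_one_iff.mpr (by linarith [mul_pos (hlam j hj) hs])
  have hsum : (1 - Real.exp (-lam j * s)) * (ξ j + ψ j) = 0 := by
    linear_combination h3 j hj + h4 j hj
  rcases mul_eq_zero.mp hsum with h | h <;> linarith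
end

section
/- Let (λ_j)_{j≥1} be positive reals, (K_j)_{j≥1}, (m_j)_{j≥1}, (ψ_j)_{j≥1} real sequences, m₀, K₀, ψ₀ ∈ ℝ, and s > 0, with ∑_{j≥1} |m_j ψ_j| < ∞ and ∑_{j≥1} |m_j K_j|/λ_j < ∞. For t ≥ 0 define v₀(t) = ψ₀ + K₀ t and v_j(t) = (ψ_j − K_j/λ_j) e^{−λ_j t} + K_j/λ_j for j ≥ 1, and assume v_j(s) = −ψ_j for all j ≥ 1. For t ∈ [s, 2s] define z₀(t) = v₀(s) − K₀(t − s) and z_j(t) = (v_j(s) + K_j/λ_j) e^{−λ_j(t−s)} − K_j/λ_j for j ≥ 1. Then: (i) z_j(2s) = ψ_j for all j ≥ 1 and z₀(2s) = ψ₀; (ii) for every θ ∈ [0, s], writing v̂(t) = m₀ v₀(t) + ∑_{j≥1} m_j v_j(t) and ẑ(t) = m₀ z₀(t) + ∑_{j≥1} m_j z_j(t), one has v̂(s) − ẑ(s + θ) = v̂(θ) − v̂(0). -/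
/-- Computational core of the lemma asserting that an initial state reaching
its negative at the first switching moment `s` generates a symmetric
`2s`-periodic solution. The sequences indexed by `j : ℕ` represent the
Fourier modes `j + 1 ≥ 1`. -/
theorem s_implies_2s
    (lam m K ψ : ℕ → ℝ) (m₀ K₀ ψ₀ s : ℝ) (hs : 0 < s)
    (hlam : ∀ j, 0 < lam j)
    (hsum₁ : Summable fun j => |m j * ψ j|)
    (hsum₂ : Summable fun j => |m j * K j| / lam j)
    (v₀ : ℝ → ℝ) (v : ℕ → ℝ → ℝ) (z₀ : ℝ → ℝ) (z : ℕ → ℝ → ℝ)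
    (hv₀ : ∀ t, v₀ t = ψ₀ + K₀ * t)
    (hv : ∀ j t, v j t =
      (ψ j - K j / lam j) * Real.exp (-lam j * t) + K j / lam j)
    (hswitch : ∀ j, v j s = -ψ j)
    (hz₀ : ∀ t, z₀ t = v₀ s - K₀ * (t - s))
    (hz : ∀ j t, z j t =
      (v j s + K j / lam j) * Real.exp (-lam j * (t - s)) - K j / lam j) :
    (∀ j, z j (2 * s) = ψ j) ∧ z₀ (2 * s) = ψ₀ ∧
      ∀ θ ∈ Set.Icc (0 : ℝ) s,
        (m₀ * v₀ s + ∑' j, m j * v j s)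
            - (m₀ * z₀ (s + θ) + ∑' j, m j * z j (s + θ))
          = (m₀ * v₀ θ + ∑' j, m j * v j θ)
            - (m₀ * v₀ 0 + ∑' j, m j * v j 0) := by
  have hz_shift : ∀ j θ, z j (s + θ) = -v j θ := fun j θ => by
    rw [hz, hswitch, hv, add_sub_cancel_left]
    ring
  have hv_zero : ∀ j, v j 0 = ψ j := fun j => by simp [hv]
  refine ⟨fun j => ?_, ?_, fun θ _ => ?_⟩
  · rw [two_mul, hz_shift, hswitch, neg_neg]
  · rw [hz₀, hv₀]
    ring
  · simp only [hz_shift, hswitch, hv_zero, mul_neg, tsum_neg, hz₀, hv₀]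
    ring
end

section
/- If in addition m₀K₀ > 0, then there exists s₀ > 0 such that the first characteristic function F is strictly increasing on [s₀, ∞), and F(s) → +∞ as s → +∞. -/
open Filter Topology

lemma one_sub_exp_div_one_add_exp_mem_Icc {x : ℝ} (hx : 0 ≤ x) :
    (1 - Real.exp (-x)) / (1 + Real.exp (-x)) ∈ Set.Icc (0 : ℝ) 1 := by
  have h₁ : Real.exp (-x) ≤ 1 := Real.exp_le_one_iff.2 (by linarith)
  have h₂ := Real.exp_pos (-x)
  exact ⟨div_nonneg (by linarith) (by linarith), (div_le_one (by linarith)).2 (by linarith)⟩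

lemma abs_one_sub_exp_div_one_add_exp_sub_le {l s t : ℝ} (hl : 0 < l) (hs : 0 < s)
    (hst : s ≤ t) :
    |(1 - Real.exp (-l * t)) / (1 + Real.exp (-l * t)) -
      (1 - Real.exp (-l * s)) / (1 + Real.exp (-l * s))| ≤ 2 * (t - s) / s := by
  have hps := Real.exp_pos (-l * s)
  have hpt := Real.exp_pos (-l * t)
  have hle : Real.exp (-l * t) ≤ Real.exp (-l * s) := Real.exp_le_exp.2 (by nlinarith)
  have hdiff : Real.exp (-l * s) - Real.exp (-l * t) ≤ Real.exp (-l * s) * (l * (t - s)) := by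
    have h : Real.exp (-l * t) = Real.exp (-l * s) * Real.exp (-(l * (t - s))) := by
      rw [← Real.exp_add]; ring_nf
    have h' := Real.add_one_le_exp (-(l * (t - s)))
    rw [h]
    nlinarith
  have hdecay : Real.exp (-l * s) * (l * s) ≤ 1 := by
    have h := Real.add_one_le_exp (l * s)
    calc Real.exp (-l * s) * (l * s) ≤ Real.exp (-l * s) * Real.exp (l * s) := by
          gcongr; linarith
      _ = 1 := by rw [← Real.exp_add]; simp
  have hexp : Real.exp (-l * s) - Real.exp (-l * t) ≤ (t - s) / s := by
    rw [le_div_iff₀ hs]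
    nlinarith [mul_le_mul_of_nonneg_right hdecay (sub_nonneg.2 hst)]
  have heq : (1 - Real.exp (-l * t)) / (1 + Real.exp (-l * t)) -
      (1 - Real.exp (-l * s)) / (1 + Real.exp (-l * s)) =
      2 * (Real.exp (-l * s) - Real.exp (-l * t)) /
        ((1 + Real.exp (-l * t)) * (1 + Real.exp (-l * s))) := by
    field_simp
    ring
  rw [heq, abs_of_nonneg (div_nonneg (by linarith) (by positivity)), mul_div_assoc 2 (t - s) s]
  refine (div_le_self (by linarith) ?_).trans (by linarith)
  nlinarith [mul_pos hps hpt]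

lemma abs_tsum_mul_le {ι : Type*} {a g : ι → ℝ} {c : ℝ} (ha : Summable fun j => |a j|)
    (hg : ∀ j, |g j| ≤ c) :
    (Summable fun j => a j * g j) ∧ |∑' j, a j * g j| ≤ (∑' j, |a j|) * c := by
  have hle : ∀ j, ‖a j * g j‖ ≤ |a j| * c := fun j => by
    rw [Real.norm_eq_abs, abs_mul]
    exact mul_le_mul_of_nonneg_left (hg j) (abs_nonneg _)
  exact ⟨.of_norm_bounded (ha.mul_right c) hle,
    tsum_of_norm_bounded (ha.hasSum.mul_right c) hle⟩

/-- If `m₀K₀ > 0`, the first characteristic function is eventually strictly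
increasing and tends to `+∞`. The sequences indexed by `j : ℕ` represent
the Fourier modes `j + 1 ≥ 1`. -/
theorem first_characteristic_increasing
    (m₀K₀ : ℝ) (lam m K : ℕ → ℝ)
    (hpos : ∀ j, 0 < lam j) (hmono : StrictMono lam)
    (hinf : Tendsto lam atTop atTop)
    (hsum : Summable fun j => |m j * K j| / lam j)
    (hm₀K₀ : 0 < m₀K₀)
    (F : ℝ → ℝ)
    (hF : ∀ s, F s = m₀K₀ * s + 2 * ∑' j, (m j * K j / lam j) *
      ((1 - Real.exp (-lam j * s)) / (1 + Real.exp (-lam j * s)))) :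
    ∃ s₀ > (0 : ℝ), StrictMonoOn F (Set.Ici s₀) ∧ Tendsto F atTop atTop := by
  set a : ℕ → ℝ := fun j => m j * K j / lam j
  have ha : Summable fun j => |a j| :=
    hsum.congr fun j => by rw [abs_div, abs_of_pos (hpos j)]
  set A := ∑' j, |a j|
  have hA : 0 ≤ A := tsum_nonneg fun j => abs_nonneg _
  set g : ℕ → ℝ → ℝ := fun j s =>
    (1 - Real.exp (-lam j * s)) / (1 + Real.exp (-lam j * s))
  have hg : ∀ s, 0 ≤ s → ∀ j, |g j s| ≤ 1 := fun s hs j => by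
    have h := one_sub_exp_div_one_add_exp_mem_Icc (mul_nonneg (hpos j).le hs)
    rw [← neg_mul] at h
    exact (abs_of_nonneg h.1).trans_le h.2
  have hF' : ∀ s, F s = m₀K₀ * s + 2 * ∑' j, a j * g j s := hF
  refine ⟨4 * A / m₀K₀ + 1, by positivity, ?_, ?_⟩
  · intro s hs t _ hst
    have hs₀ : 4 * A / m₀K₀ < s := by linarith [Set.mem_Ici.1 hs]
    have hspos : 0 < s := lt_of_le_of_lt (by positivity) hs₀
    have hlt : 4 * A / s < m₀K₀ := by
      rw [div_lt_iff₀ hm₀K₀] at hs₀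
      rw [div_lt_iff₀ hspos]
      linarith
    have hbound := (abs_tsum_mul_le (g := fun j => g j t - g j s) ha fun j =>
      abs_one_sub_exp_div_one_add_exp_sub_le (hpos j) hspos hst.le).2
    have hsub : ∑' j, a j * (g j t - g j s) = ∑' j, a j * g j t - ∑' j, a j * g j s := by
      simp_rw [mul_sub]
      exact (abs_tsum_mul_le ha (hg t (hspos.trans hst).le)).1.tsum_sub
        (abs_tsum_mul_le ha (hg s hspos.le)).1
    rw [hsub] at hbound
    have hmul := mul_lt_mul_of_pos_right hlt (sub_pos.2 hst)
    have heq : 4 * A / s * (t - s) = 2 * (A * (2 * (t - s) / s)) := by ring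
    rw [hF', hF']
    linarith [(abs_le.1 hbound).1]
  · have hlin : Tendsto (fun s => m₀K₀ * s + -(2 * A)) atTop atTop :=
      tendsto_atTop_add_const_right _ _ (tendsto_id.const_mul_atTop hm₀K₀)
    refine tendsto_atTop_mono' _ ?_ hlin
    filter_upwards [eventually_ge_atTop 0] with s hs
    have h := (abs_le.1 (abs_tsum_mul_le ha (hg s hs)).2).1
    rw [hF']
    linarith
end

section
/- If in addition m₀K₀ > 0, then for every b > 0 the set { s > 0 : F(s) = b } is finite; that is, the first characteristic equation F(s) = β − α has only finitely many positive roots for each β − α > 0. -/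
open Filter Topology

/-- The quotient `(1 - exp x) / (1 + exp x)` has absolute value at most one. -/
lemma abs_one_sub_exp_div_one_add_exp_le_one (x : ℝ) :
    |(1 - Real.exp x) / (1 + Real.exp x)| ≤ 1 := by
  have h := Real.exp_pos x
  rw [abs_div, abs_of_pos (by linarith : 0 < 1 + Real.exp x), div_le_one (by linarith), abs_le]
  constructor <;> linarith

lemma norm_one_sub_div_one_add_le {w : ℂ} {r : ℝ} (hr : r < 1) (hw : ‖w‖ ≤ r) :
    ‖(1 - w) / (1 + w)‖ ≤ 2 / (1 - r) := by
  have h₁ : ‖1 - w‖ ≤ 2 := by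
    have := norm_sub_le (1 : ℂ) w
    rw [norm_one] at this
    linarith
  have h₂ : 1 - r ≤ ‖1 + w‖ := by
    have := norm_sub_norm_le (1 : ℂ) (-w)
    rw [norm_one, norm_neg, sub_neg_eq_add] at this
    linarith
  rw [norm_div]
  exact div_le_div₀ zero_le_two h₁ (by linarith) h₂

/-- A summable series of terms `a j * (1 - exp (-lam j * z)) / (1 + exp (-lam j * z))` is
holomorphic on every half plane `c < re z` with `0 < c`, if the `lam j` are bounded below by a
positive number. -/
lemma differentiableOn_tsum_one_sub_exp_div {a lam : ℕ → ℝ} {l c : ℝ} (hl : 0 < l)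
    (hlam : ∀ j, l ≤ lam j) (ha : Summable fun j => |a j|) (hc : 0 < c) :
    DifferentiableOn ℂ (fun z : ℂ => ∑' j, (a j : ℂ) *
      ((1 - Complex.exp (-lam j * z)) / (1 + Complex.exp (-lam j * z)))) {z | c < z.re} := by
  have hr : Real.exp (-(l * c)) < 1 := Real.exp_lt_one_iff.2 (neg_neg_of_pos (mul_pos hl hc))
  have hw : ∀ j, ∀ z ∈ {z : ℂ | c < z.re},
      ‖Complex.exp (-lam j * z)‖ ≤ Real.exp (-(l * c)) := by
    intro j z hz
    rw [Set.mem_ofPred_eq] at hz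
    rw [Complex.norm_exp, Real.exp_le_exp, ← Complex.ofReal_neg, Complex.re_ofReal_mul, neg_mul,
      neg_le_neg_iff]
    exact mul_le_mul (hlam j) hz.le hc.le (hl.le.trans (hlam j))
  refine Complex.differentiableOn_tsum_of_summable_norm (ha.mul_right (2 / (1 - Real.exp (-(l * c)))))
    (fun j => ?_) (isOpen_lt continuous_const Complex.continuous_re) fun j z hz => ?_
  · refine DifferentiableOn.const_mul (DifferentiableOn.div (by fun_prop) (by fun_prop) ?_) _
    intro z hz h
    have := hw j z hz
    rw [eq_neg_of_add_eq_zero_right h, norm_neg, norm_one] at this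
    linarith
  · rw [norm_mul, Complex.norm_real, Real.norm_eq_abs]
    exact mul_le_mul_of_nonneg_left (norm_one_sub_div_one_add_le hr (hw j z hz)) (abs_nonneg _)

lemma analyticOnNhd_tsum_one_sub_exp_div {a lam : ℕ → ℝ} {l : ℝ} (hl : 0 < l)
    (hlam : ∀ j, l ≤ lam j) (ha : Summable fun j => |a j|) :
    AnalyticOnNhd ℝ (fun s : ℝ => ∑' j, a j *
      ((1 - Real.exp (-lam j * s)) / (1 + Real.exp (-lam j * s)))) (Set.Ioi 0) := by
  intro s hs
  have hs : 0 < s := hs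
  have h := ((differentiableOn_tsum_one_sub_exp_div hl hlam ha (half_pos hs)).analyticAt
    (z := (s : ℂ)) ((isOpen_lt continuous_const Complex.continuous_re).mem_nhds
      (by simpa using hs))).re_ofReal
  convert h using 2 with t
  rw [← Complex.ofReal_re (∑' j, _), Complex.ofReal_tsum]
  push_cast
  rfl

lemma continuous_tsum_one_sub_exp_div {a lam : ℕ → ℝ} (ha : Summable fun j => |a j|) :
    Continuous fun s : ℝ => ∑' j, a j *
      ((1 - Real.exp (-lam j * s)) / (1 + Real.exp (-lam j * s))) := by
  refine continuous_tsum (fun j => ?_) ha fun j s => ?_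
  · exact continuous_const.mul (Continuous.div (by fun_prop) (by fun_prop) fun s => by positivity)
  · rw [norm_mul, Real.norm_eq_abs, Real.norm_eq_abs]
    exact mul_le_of_le_one_right (abs_nonneg _) (abs_one_sub_exp_div_one_add_exp_le_one _)

lemma abs_tsum_one_sub_exp_div_le {a lam : ℕ → ℝ} (ha : Summable fun j => |a j|) (s : ℝ) :
    |∑' j, a j * ((1 - Real.exp (-lam j * s)) / (1 + Real.exp (-lam j * s)))| ≤ ∑' j, |a j| := by
  rw [← Real.norm_eq_abs]
  refine tsum_of_norm_bounded ha.hasSum fun j => ?_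
  rw [norm_mul, Real.norm_eq_abs, Real.norm_eq_abs]
  exact mul_le_of_le_one_right (abs_nonneg _) (abs_one_sub_exp_div_one_add_exp_le_one _)

/-- A continuous function that is analytic on the positive reals, vanishes at zero and tends to
infinity takes every nonzero value only finitely often on the positive reals. -/
lemma finite_setOf_pos_eq_of_analyticOnNhd {f : ℝ → ℝ} (hf : AnalyticOnNhd ℝ f (Set.Ioi 0))
    (hcont : ContinuousAt f 0) (h₀ : f 0 = 0) (htop : Tendsto f atTop atTop) {b : ℝ}
    (hb : b ≠ 0) : {s : ℝ | 0 < s ∧ f s = b}.Finite := by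
  obtain ⟨M, hM⟩ := eventually_atTop.1 (htop.eventually_gt_atTop b)
  obtain ⟨ε, hε, hεb⟩ := Metric.eventually_nhds_iff.1
    (hcont.eventually_ne (h₀.trans_ne hb.symm))
  have hsub : {s : ℝ | 0 < s ∧ f s = b} ⊆ Set.Icc ε M := by
    rintro s ⟨hs, hsb⟩
    constructor
    · by_contra! h
      exact hεb (by rwa [Real.dist_0_eq_abs, abs_of_pos hs]) hsb
    · by_contra! h
      exact (hM s h.le).ne' hsb
  by_contra hinf
  obtain ⟨z, hz, hacc⟩ :=
    Set.Infinite.exists_accPt_of_subset_isCompact hinf isCompact_Icc hsub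
  have heq : Set.EqOn f (fun _ => b) (Set.Ioi 0) :=
    hf.eqOn_of_preconnected_of_frequently_eq analyticOnNhd_const isPreconnected_Ioi
      (hε.trans_le hz.1) ((accPt_iff_frequently_nhdsNE.1 hacc).mono fun _ h => h.2)
  exact (hM (max M 1) (le_max_left _ _)).ne'
    (heq (zero_lt_one.trans_le (le_max_right M 1)))

/-- If `m₀K₀ > 0`, the first characteristic equation `F s = b` has only
finitely many positive roots for every `b > 0`. -/
theorem first_characteristic_finitely_many_roots
    (m₀K₀ : ℝ) (lam m K : ℕ → ℝ)
    (hpos : ∀ j, 0 < lam j) (hmono : StrictMono lam)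
    (hinf : Tendsto lam atTop atTop)
    (hsum : Summable fun j => |m j * K j| / lam j)
    (hm₀K₀ : 0 < m₀K₀)
    (F : ℝ → ℝ)
    (hF : ∀ s, F s = m₀K₀ * s + 2 * ∑' j, (m j * K j / lam j) *
      ((1 - Real.exp (-lam j * s)) / (1 + Real.exp (-lam j * s)))) :
    ∀ b > (0 : ℝ), {s : ℝ | 0 < s ∧ F s = b}.Finite := by
  intro b hb
  have ha : Summable fun j => |m j * K j / lam j| := by
    simpa only [abs_div, abs_of_pos (hpos _)] using hsum
  obtain rfl := funext hF
  refine finite_setOf_pos_eq_of_analyticOnNhd ?_ ?_ (by simp) ?_ hb.ne'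
  · exact (analyticOnNhd_const.mul analyticOnNhd_id).add (analyticOnNhd_const.mul
      (analyticOnNhd_tsum_one_sub_exp_div (hpos 0) (fun j => hmono.monotone j.zero_le) ha))
  · exact ((continuous_const.mul continuous_id).add
      (continuous_const.mul (continuous_tsum_one_sub_exp_div ha))).continuousAt
  · refine tendsto_atTop_add_right_of_le _ (-(2 * ∑' j, |m j * K j / lam j|))
      (tendsto_id.const_mul_atTop hm₀K₀) fun s => ?_
    have := (abs_le.1 (abs_tsum_one_sub_exp_div_le (lam := lam) ha s)).1
    linarith
end

section
/- The second characteristic function H is continuous on the set { (t, s) ∈ ℝ² : 0 ≤ t ≤ s }; for each fixed s > 0 the function t ↦ H(t, s) is real-analytic on (0, ∞); and for every s ≥ 0 one has H(0, s) = −F(s) and H(s, s) = 0. -/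
open Filter Topology

/-- A series `∑ cⱼ (aⱼ - e^{-λⱼ z}) bⱼ` with absolutely summable coefficients and bounded `aⱼ`,
`bⱼ` is holomorphic on the right half-plane. -/
theorem differentiableOn_tsum_sub_cexp {lam c a b : ℕ → ℝ} (hpos : ∀ j, 0 < lam j)
    (hc : Summable fun j => |c j|) (ha : ∀ j, |a j| ≤ 1) (hb : ∀ j, |b j| ≤ 1) :
    DifferentiableOn ℂ
      (fun z : ℂ => ∑' j, (c j : ℂ) * (((a j : ℂ) - Complex.exp (-lam j * z)) * b j))
      {z : ℂ | 0 < z.re} := by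
  refine Complex.differentiableOn_tsum_of_summable_norm (hc.mul_right 2) ?_
    (isOpen_lt continuous_const Complex.continuous_re) ?_
  · intro j
    fun_prop
  · intro j z hz
    have hexp : ‖Complex.exp (-lam j * z)‖ ≤ 1 := by
      rw [Complex.norm_exp, Real.exp_le_one_iff]
      have := mul_pos (hpos j) hz
      simpa using this.le
    have hab : ‖(a j : ℂ) - Complex.exp (-lam j * z)‖ ≤ 2 := by
      refine (norm_sub_le _ _).trans ?_
      have := ha j
      rw [Complex.norm_real, Real.norm_eq_abs]
      linarith
    rw [norm_mul, norm_mul, Complex.norm_real, Complex.norm_real, Real.norm_eq_abs,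
      Real.norm_eq_abs]
    refine mul_le_mul_of_nonneg_left ?_ (abs_nonneg _)
    calc _ ≤ (2 : ℝ) * 1 := mul_le_mul hab (hb j) (abs_nonneg _) (by norm_num)
      _ = 2 := by norm_num

theorem analyticOnNhd_tsum_sub_exp {lam c a b : ℕ → ℝ} (hpos : ∀ j, 0 < lam j)
    (hc : Summable fun j => |c j|) (ha : ∀ j, |a j| ≤ 1) (hb : ∀ j, |b j| ≤ 1) :
    AnalyticOnNhd ℝ (fun t : ℝ => ∑' j, c j * ((a j - Real.exp (-lam j * t)) * b j))
      (Set.Ioi 0) := by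
  intro t ht
  have hG := (differentiableOn_tsum_sub_cexp hpos hc ha hb).analyticAt (z := (t : ℂ))
    ((isOpen_lt continuous_const Complex.continuous_re).mem_nhds (by simpa using ht))
  refine hG.re_ofReal.congr (Eventually.of_forall fun x => ?_)
  dsimp only
  rw [← Complex.ofReal_re (∑' j, c j * ((a j - Real.exp (-lam j * x)) * b j))]
  push_cast
  rfl

theorem continuousOn_tsum_exp_sub_exp_div {lam c : ℕ → ℝ} (hpos : ∀ j, 0 < lam j)
    (hc : Summable fun j => |c j|) :
    ContinuousOn (fun p : ℝ × ℝ => ∑' j, c j *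
        ((Real.exp (-lam j * p.2) - Real.exp (-lam j * p.1)) / (1 + Real.exp (-lam j * p.2))))
      {p : ℝ × ℝ | 0 ≤ p.1 ∧ p.1 ≤ p.2} := by
  refine continuousOn_tsum (fun j => ?_) hc ?_
  · have hne (p : ℝ × ℝ) : 1 + Real.exp (-lam j * p.2) ≠ 0 := by positivity
    exact Continuous.continuousOn (by fun_prop (disch := exact hne _))
  · rintro j ⟨t, s⟩ ⟨ht, -⟩
    have hs := Real.exp_pos (-lam j * s)
    have ht₀ := Real.exp_pos (-lam j * t)
    have ht₁ : Real.exp (-lam j * t) ≤ 1 := by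
      rw [Real.exp_le_one_iff]
      have := mul_nonneg (hpos j).le ht
      linarith
    rw [Real.norm_eq_abs, abs_mul]
    refine mul_le_of_le_one_right (abs_nonneg _) ?_
    rw [abs_div, abs_of_pos (a := 1 + _) (by positivity), div_le_one (by positivity), abs_le]
    constructor <;> dsimp only <;> linarith

/-- The second characteristic function `H` is continuous on
`{(t, s) : 0 ≤ t ≤ s}`, real-analytic in `t` on `(0, ∞)` for each fixed
`s > 0`, and satisfies `H 0 s = -F s` and `H s s = 0`. -/
theorem second_characteristic_properties
    (m₀K₀ : ℝ) (lam m K : ℕ → ℝ)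
    (hpos : ∀ j, 0 < lam j) (hmono : StrictMono lam)
    (hinf : Tendsto lam atTop atTop)
    (hsum : Summable fun j => |m j * K j| / lam j)
    (F : ℝ → ℝ)
    (hF : ∀ s, F s = m₀K₀ * s + 2 * ∑' j, (m j * K j / lam j) *
      ((1 - Real.exp (-lam j * s)) / (1 + Real.exp (-lam j * s))))
    (H : ℝ → ℝ → ℝ)
    (hH : ∀ t s, H t s = m₀K₀ * (t - s) + 2 * ∑' j, (m j * K j / lam j) *
      ((Real.exp (-lam j * s) - Real.exp (-lam j * t)) /
        (1 + Real.exp (-lam j * s)))) :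
    ContinuousOn (fun p : ℝ × ℝ => H p.1 p.2)
        {p : ℝ × ℝ | 0 ≤ p.1 ∧ p.1 ≤ p.2} ∧
      (∀ s > (0 : ℝ), AnalyticOnNhd ℝ (fun t => H t s) (Set.Ioi 0)) ∧
      ∀ s ≥ (0 : ℝ), H 0 s = -F s ∧ H s s = 0 := by
  have hc : Summable fun j => |m j * K j / lam j| := by
    refine hsum.congr fun j => ?_
    rw [abs_div, abs_of_pos (hpos j)]
  refine ⟨?_, fun s hs => ?_, fun s _ => ⟨?_, ?_⟩⟩
  · simp only [hH]
    exact (Continuous.continuousOn (by fun_prop)).add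
      (continuousOn_const.mul (continuousOn_tsum_exp_sub_exp_div hpos hc))
  · simp only [hH, div_eq_mul_inv (_ - _)]
    have hlin : AnalyticOnNhd ℝ (fun t : ℝ => m₀K₀ * (t - s)) (Set.Ioi 0) := fun t _ => by
      fun_prop
    refine hlin.add (analyticOnNhd_const.mul (analyticOnNhd_tsum_sub_exp hpos hc ?_ ?_))
    · intro j
      rw [abs_of_pos (Real.exp_pos _), Real.exp_le_one_iff]
      have := mul_pos (hpos j) hs
      linarith
    · intro j
      have := Real.exp_pos (-lam j * s)
      rw [abs_of_pos (by positivity)]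
      exact inv_le_one_of_one_le₀ (by linarith)
  · have hneg (j : ℕ) : m j * K j / lam j *
        ((Real.exp (-lam j * s) - Real.exp (-lam j * 0)) / (1 + Real.exp (-lam j * s))) =
        -(m j * K j / lam j *
          ((1 - Real.exp (-lam j * s)) / (1 + Real.exp (-lam j * s)))) := by
      rw [mul_zero, Real.exp_zero]
      ring
    rw [hH, hF, tsum_congr hneg, tsum_neg]
    ring
  · simp [hH]
end

section
/- If s > 0 and F(s) > 0, then the second characteristic equation has only finitely many roots in t on the interval (0, s); that is, the set { t ∈ (0, s) : H(t, s) = 0 } is finite. -/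
open Filter Topology

/-- A function that is holomorphic on the open right half-plane, continuous up to the boundary and
nonzero at the origin has finitely many zeros on each real interval `(0, s)`. -/
theorem finite_real_zeros_of_differentiableOn_right_half_plane {g : ℂ → ℂ}
    (hc : ContinuousOn g {z | 0 ≤ z.re}) (hd : DifferentiableOn ℂ g {z | 0 < z.re})
    (h0 : g 0 ≠ 0) (s : ℝ) : {t : ℝ | t ∈ Set.Ioo 0 s ∧ g t = 0}.Finite := by
  by_contra hinf
  obtain ⟨x, hx, hacc⟩ := Set.Infinite.exists_accPt_of_subset_isCompact hinf
    (isCompact_Icc (a := (0 : ℝ)) (b := s)) fun t ht => Set.Ioo_subset_Icc_self ht.1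
  have hr : ContinuousOn (fun t : ℝ => g t) (Set.Ici 0) :=
    hc.comp Complex.continuous_ofReal.continuousOn fun t ht => by simpa using ht
  have eq_zero_of_mem_closure : ∀ {S : Set ℝ} {y : ℝ}, y ∈ closure S → 0 ≤ y → S ⊆ Set.Ici 0 →
      (∀ t ∈ S, g t = 0) → g y = 0 := by
    intro S y hy hy0 hS hz
    have hmem := ((hr y hy0).mono hS).mem_closure_image hy
    have himg : (fun t : ℝ => g t) '' S ⊆ {0} := by
      rintro _ ⟨t, ht, rfl⟩
      exact hz t ht
    simpa using closure_mono himg hmem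
  have hgx : g x = 0 := eq_zero_of_mem_closure (mem_closure_iff_clusterPt.2 hacc.clusterPt) hx.1
    (fun t ht => ht.1.1.le) fun t ht => ht.2
  have hxpos : 0 < x := hx.1.lt_of_ne (by rintro rfl; exact h0 (by simpa using hgx))
  have hopen : IsOpen {z : ℂ | 0 < z.re} := isOpen_lt continuous_const Complex.continuous_re
  have hfreq : ∃ᶠ z in 𝓝[≠] (x : ℂ), g z = 0 := by
    have hmap : Tendsto (fun t : ℝ => (t : ℂ)) (𝓝[≠] x) (𝓝[≠] (x : ℂ)) :=
      Complex.continuous_ofReal.continuousAt.continuousWithinAt.tendsto_nhdsWithin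
        fun t ht => by simpa using ht
    exact hmap.frequently ((accPt_iff_frequently_nhdsNE.1 hacc).mono fun t ht => ht.2)
  have hzero := (hd.analyticOnNhd hopen).eqOn_zero_of_preconnected_of_frequently_eq_zero
    (convex_halfSpace_re_gt 0).isPreconnected (z₀ := (x : ℂ)) (by simpa using hxpos) hfreq
  refine h0 ?_
  have := eq_zero_of_mem_closure (S := Set.Ioi 0) (y := 0) (by simp) le_rfl
    Set.Ioi_subset_Ici_self fun t ht => hzero (by simpa using ht)
  simpa using this

/-- If `s > 0` and `F s > 0`, the second characteristic equation
`H t s = 0` has only finitely many roots `t` in `(0, s)`. -/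
theorem second_characteristic_finitely_many_roots
    (m₀K₀ : ℝ) (lam m K : ℕ → ℝ)
    (hpos : ∀ j, 0 < lam j) (hmono : StrictMono lam)
    (hinf : Tendsto lam atTop atTop)
    (hsum : Summable fun j => |m j * K j| / lam j)
    (F : ℝ → ℝ)
    (hF : ∀ s, F s = m₀K₀ * s + 2 * ∑' j, (m j * K j / lam j) *
      ((1 - Real.exp (-lam j * s)) / (1 + Real.exp (-lam j * s))))
    (H : ℝ → ℝ → ℝ)
    (hH : ∀ t s, H t s = m₀K₀ * (t - s) + 2 * ∑' j, (m j * K j / lam j) *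
      ((Real.exp (-lam j * s) - Real.exp (-lam j * t)) /
        (1 + Real.exp (-lam j * s))))
    (s : ℝ) (hs : 0 < s) (hFs : 0 < F s) :
    {t : ℝ | t ∈ Set.Ioo 0 s ∧ H t s = 0}.Finite := by
  let f : ℕ → ℂ → ℂ := fun j z => ((m j * K j / lam j : ℝ) : ℂ) *
    (((Real.exp (-lam j * s) : ℂ) - Complex.exp (-lam j * z)) /
      ((1 + Real.exp (-lam j * s) : ℝ) : ℂ))
  let g : ℂ → ℂ := fun z => m₀K₀ * (z - s) + 2 * ∑' j, f j z
  have hgH : ∀ t : ℝ, g t = H t s := by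
    intro t
    simp only [g, f, hH]
    push_cast
    rfl
  have hbound : ∀ j z, z ∈ {z : ℂ | 0 ≤ z.re} → ‖f j z‖ ≤ |m j * K j| / lam j * 2 := by
    intro j z hz
    have hl := hpos j
    have hE := Real.exp_pos (-lam j * s)
    have hexp : ‖Complex.exp (-lam j * z)‖ ≤ 1 := by
      rw [Complex.norm_exp, Real.exp_le_one_iff]
      simpa using mul_nonneg hl.le hz
    simp only [f, norm_mul, norm_div, Complex.norm_real, Real.norm_eq_abs, abs_mul,
      abs_of_pos hl, abs_of_pos (add_pos one_pos hE)]
    gcongr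
    rw [div_le_iff₀ (by positivity)]
    refine (norm_sub_le _ _).trans ?_
    rw [Complex.norm_real, Real.norm_of_nonneg hE.le]
    linarith
  have hsum2 := hsum.mul_right 2
  have hfd : ∀ j, Differentiable ℂ (f j) := fun j => by fun_prop
  have hopen : IsOpen {z : ℂ | 0 < z.re} := isOpen_lt continuous_const Complex.continuous_re
  have hgc : ContinuousOn g {z | 0 ≤ z.re} := by
    have := continuousOn_tsum (fun j => (hfd j).continuous.continuousOn) hsum2 hbound
    fun_prop
  have hgd : DifferentiableOn ℂ g {z | 0 < z.re} := by
    have := Complex.differentiableOn_tsum_of_summable_norm hsum2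
      (fun j => (hfd j).differentiableOn) hopen fun j z hz => hbound j z (Set.mem_ofPred.2 (Set.mem_ofPred.1 hz).le)
    fun_prop
  have hHF : H 0 s = -F s := by
    rw [hH, hF, neg_add, ← mul_neg 2, ← tsum_neg]
    congr 1
    · ring
    · congr 2 with j
      simp only [mul_zero, Real.exp_zero]
      ring
  have hg0 : g 0 ≠ 0 := by
    have := hgH 0
    rw [Complex.ofReal_zero] at this
    rw [this, hHF]
    exact_mod_cast (neg_neg_of_pos hFs).ne
  simpa only [hgH, Complex.ofReal_eq_zero] using
    finite_real_zeros_of_differentiableOn_right_half_plane hgc hgd hg0 s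
end

section
/- If in addition ∑_{j≥1} |m_j K_j| < ∞, then F(s)/s → m₀K₀ + ∑_{j≥1} m_j K_j as s → 0⁺; that is, the first characteristic function is right-differentiable at 0 with derivative M = ∑_{j≥0} m_j K_j. -/
open Filter Topology

/-- The right derivative at `0` of `s ↦ (1 - e^{-ls}) / (1 + e^{-ls})` is `l / 2`. -/
lemma tendsto_one_sub_exp_div_one_add_exp_div (l : ℝ) :
    Tendsto (fun s => (1 - Real.exp (-l * s)) / (1 + Real.exp (-l * s)) / s) (𝓝[>] 0)
      (𝓝 (l / 2)) := by
  have hexp : HasDerivAt (fun s : ℝ => Real.exp (-l * s)) (-l) 0 := by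
    simpa using ((hasDerivAt_id (0 : ℝ)).const_mul (-l)).exp
  have hderiv : HasDerivAt
      (fun s : ℝ => (1 - Real.exp (-l * s)) / (1 + Real.exp (-l * s))) (l / 2) 0 := by
    refine ((hexp.const_sub 1).div (hexp.const_add 1) (by positivity)).congr_deriv ?_
    norm_num
    ring
  refine (hderiv.tendsto_slope.mono_left
    (nhdsWithin_mono _ fun s (hs : 0 < s) => hs.ne')).congr fun s => ?_
  simp [slope_def_field]

/-- For `x ≥ 0`, the quotient `(1 - e^{-x}) / (1 + e^{-x})` is at most `x` in absolute value. -/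
lemma abs_one_sub_exp_div_one_add_exp_le {x : ℝ} (hx : 0 ≤ x) :
    |(1 - Real.exp (-x)) / (1 + Real.exp (-x))| ≤ x := by
  have hle : Real.exp (-x) ≤ 1 := Real.exp_le_one_iff.2 (by linarith)
  have hge := Real.add_one_le_exp (-x)
  have hpos := Real.exp_pos (-x)
  rw [abs_of_nonneg (div_nonneg (by linarith) (by linarith)), div_le_iff₀ (by linarith)]
  nlinarith [mul_nonneg hx hpos.le]

/-- If additionally `∑ |mⱼ Kⱼ| < ∞`, then `F s / s → m₀K₀ + ∑ mⱼ Kⱼ` as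
`s → 0⁺`: the first characteristic function is right-differentiable at `0`
with derivative `M = ∑_{j≥0} mⱼ Kⱼ`. -/
theorem first_characteristic_right_derivative_at_zero
    (m₀K₀ : ℝ) (lam m K : ℕ → ℝ)
    (hpos : ∀ j, 0 < lam j) (hmono : StrictMono lam)
    (hinf : Tendsto lam atTop atTop)
    (hsum : Summable fun j => |m j * K j| / lam j)
    (hsum' : Summable fun j => |m j * K j|)
    (F : ℝ → ℝ)
    (hF : ∀ s, F s = m₀K₀ * s + 2 * ∑' j, (m j * K j / lam j) *
      ((1 - Real.exp (-lam j * s)) / (1 + Real.exp (-lam j * s)))) :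
    Tendsto (fun s => F s / s) (𝓝[>] 0)
      (𝓝 (m₀K₀ + ∑' j, m j * K j)) := by
  set g : ℝ → ℕ → ℝ := fun s j => 2 * (m j * K j / lam j) *
    ((1 - Real.exp (-lam j * s)) / (1 + Real.exp (-lam j * s)) / s) with hg
  have hlim : Tendsto (fun s => ∑' j, g s j) (𝓝[>] 0) (𝓝 (∑' j, m j * K j)) := by
    refine tendsto_tsum_of_dominated_convergence (hsum'.mul_left 2) (fun j => ?_) ?_
    · have hl := (hpos j).ne'
      convert (tendsto_one_sub_exp_div_one_add_exp_div (lam j)).const_mul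
        (2 * (m j * K j / lam j)) using 2
      field_simp
    · filter_upwards [self_mem_nhdsWithin] with s (hs : 0 < s) j
      have hl := hpos j
      have hbound := abs_one_sub_exp_div_one_add_exp_le (mul_pos hl hs).le
      rw [← neg_mul] at hbound
      rw [hg, Real.norm_eq_abs, abs_mul, abs_mul, abs_div, abs_div _ s, abs_of_pos hl,
        abs_of_pos hs, abs_two]
      calc 2 * (|m j * K j| / lam j) * (_ / s)
          ≤ 2 * (|m j * K j| / lam j) * (lam j * s / s) := by gcongr
        _ = 2 * |m j * K j| := by field_simp
  refine (hlim.const_add m₀K₀).congr' ?_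
  filter_upwards [self_mem_nhdsWithin] with s (hs : 0 < s)
  rw [hF, add_div, mul_div_cancel_right₀ _ hs.ne', ← tsum_mul_left, ← tsum_div_const]
  congr 1
  refine tsum_congr fun j => ?_
  rw [hg]
  ring
end

section
/- Assume in addition ∑_{j≥1} |m_j K_j| < ∞ and M = m₀K₀ + ∑_{j≥1} m_j K_j > 0. Then there exist ω > 0 and σ > 0 such that for every b ∈ (0, ω] the equation F(s) = b has a unique solution s = s(b) in (0, σ]; moreover, on (0, ω] the function b ↦ s(b) is strictly monotonically increasing, and s(b) → 0 as b → 0⁺. (This is the reduction of the theorem asserting existence of a 2s-periodic solution for every sufficiently small threshold difference β − α, with half-period s = s(β − α).) -/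
open Filter Topology

/-- A continuous function on `[0, σ]` that is strictly increasing with value `0` at `0` has a strictly
increasing right inverse on `(0, f σ]`, which tends to `0` at `0⁺`. -/
theorem exists_strictMonoOn_rightInverse_tendsto_zero {f : ℝ → ℝ} {σ : ℝ} (hσ : 0 < σ)
    (hf : StrictMonoOn f (Set.Icc 0 σ)) (hc : ContinuousOn f (Set.Icc 0 σ)) (h0 : f 0 = 0) :
    ∃ ω > (0 : ℝ), ∃ g : ℝ → ℝ,
      (∀ b ∈ Set.Ioc (0 : ℝ) ω,
        g b ∈ Set.Ioc (0 : ℝ) σ ∧ f (g b) = b ∧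
          ∀ s' ∈ Set.Ioc (0 : ℝ) σ, f s' = b → s' = g b) ∧
      StrictMonoOn g (Set.Ioc (0 : ℝ) ω) ∧
      Tendsto g (𝓝[>] 0) (𝓝 0) := by
  have hpos : ∀ s ∈ Set.Ioc (0 : ℝ) σ, 0 < f s := fun s hs => by
    simpa [h0] using hf (Set.left_mem_Icc.2 hσ.le) (Set.Ioc_subset_Icc_self hs) hs.1
  have hω : 0 < f σ := hpos σ ⟨hσ, le_rfl⟩
  have hsol : ∀ b, ∃ s, b ∈ Set.Ioc 0 (f σ) → s ∈ Set.Ioc 0 σ ∧ f s = b := by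
    intro b
    by_cases hb : b ∈ Set.Ioc 0 (f σ)
    · rw [← h0] at hb
      obtain ⟨s, hs, hsb⟩ := intermediate_value_Ioc hσ.le hc hb
      exact ⟨s, fun _ => ⟨hs, hsb⟩⟩
    · exact ⟨0, fun h => absurd h hb⟩
  choose g hg using hsol
  refine ⟨f σ, hω, g, fun b hb => ⟨(hg b hb).1, (hg b hb).2, fun s' hs' h => ?_⟩, ?_, ?_⟩
  · exact hf.injOn (Set.Ioc_subset_Icc_self hs') (Set.Ioc_subset_Icc_self (hg b hb).1)
      (h.trans (hg b hb).2.symm)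
  · intro a ha b hb hab
    rw [← hf.lt_iff_lt (Set.Ioc_subset_Icc_self (hg a ha).1)
      (Set.Ioc_subset_Icc_self (hg b hb).1), (hg a ha).2, (hg b hb).2]
    exact hab
  · rw [Metric.tendsto_nhds]
    intro ε hε
    have hδ : min ε σ ∈ Set.Ioc 0 σ := ⟨lt_min hε hσ, min_le_right _ _⟩
    have hle : f (min ε σ) ≤ f σ :=
      hf.monotoneOn (Set.Ioc_subset_Icc_self hδ) (Set.right_mem_Icc.2 hσ.le) hδ.2
    filter_upwards [Ioo_mem_nhdsGT (hpos _ hδ)] with b hb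
    obtain ⟨hs, hsb⟩ := hg b ⟨hb.1, hb.2.le.trans hle⟩
    have hlt : g b < min ε σ := by
      rw [← hf.lt_iff_lt (Set.Ioc_subset_Icc_self hs) (Set.Ioc_subset_Icc_self hδ), hsb]
      exact hb.2
    rw [Real.dist_eq, sub_zero, abs_of_pos hs.1]
    exact hlt.trans_le (min_le_left _ _)

theorem hasDerivAt_one_sub_exp_div_one_add_exp (l s : ℝ) :
    HasDerivAt (fun s => (1 - Real.exp (-l * s)) / (1 + Real.exp (-l * s)))
      (2 * l * Real.exp (-l * s) / (1 + Real.exp (-l * s)) ^ 2) s := by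
  have he : HasDerivAt (fun s => Real.exp (-l * s)) (Real.exp (-l * s) * -l) s := by
    simpa using ((hasDerivAt_id s).const_mul (-l)).exp
  have hne : 1 + Real.exp (-l * s) ≠ 0 := by positivity
  refine ((he.const_sub 1).div (he.const_add 1) hne).congr_deriv ?_
  ring

theorem hasDerivAt_tsum_one_sub_exp_div_one_add_exp {lam a : ℕ → ℝ} (hpos : ∀ j, 0 < lam j)
    (ha : Summable fun j => |a j|) :
    ∃ G : ℝ → ℝ, Continuous G ∧ G 0 = (∑' j, a j) / 2 ∧ ∀ s, HasDerivAt
      (fun s => ∑' j, (a j / lam j) *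
        ((1 - Real.exp (-lam j * s)) / (1 + Real.exp (-lam j * s)))) (G s) s := by
  have hbound : ∀ j s, ‖a j * (2 * Real.exp (-lam j * s) / (1 + Real.exp (-lam j * s)) ^ 2)‖
      ≤ |a j| := by
    intro j s
    have he := Real.exp_pos (-lam j * s)
    rw [norm_mul, Real.norm_eq_abs, Real.norm_eq_abs]
    refine mul_le_of_le_one_right (abs_nonneg _) ?_
    rw [abs_of_pos (by positivity), div_le_one (by positivity)]
    nlinarith [sq_nonneg (Real.exp (-lam j * s))]
  refine ⟨fun s => ∑' j, a j * (2 * Real.exp (-lam j * s) / (1 + Real.exp (-lam j * s)) ^ 2),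
    ?_, ?_, ?_⟩
  · refine continuous_tsum (fun j => ?_) ha hbound
    have hne : ∀ s, (1 + Real.exp (-lam j * s)) ^ 2 ≠ 0 := fun s => by positivity
    fun_prop (disch := exact hne _)
  · rw [← tsum_div_const]
    refine tsum_congr fun j => ?_
    norm_num
    ring
  · refine hasDerivAt_tsum ha (fun j s => ?_) hbound (y₀ := 0) (by simp)
    have hl := (hpos j).ne'
    refine ((hasDerivAt_one_sub_exp_div_one_add_exp (lam j) s).const_mul
      (a j / lam j)).congr_deriv ?_
    field_simp

/-- If `M = m₀K₀ + ∑ mⱼ Kⱼ > 0`, then for every sufficiently small `b > 0`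
the equation `F s = b` has a unique small positive solution `s = s(b)`,
which is strictly increasing in `b` and tends to `0` as `b → 0⁺`. -/
theorem exists_periodic_solution_small_threshold
    (m₀K₀ : ℝ) (lam m K : ℕ → ℝ)
    (hpos : ∀ j, 0 < lam j) (hmono : StrictMono lam)
    (hinf : Tendsto lam atTop atTop)
    (hsum : Summable fun j => |m j * K j| / lam j)
    (hsum' : Summable fun j => |m j * K j|)
    (hM : 0 < m₀K₀ + ∑' j, m j * K j)
    (F : ℝ → ℝ)
    (hF : ∀ s, F s = m₀K₀ * s + 2 * ∑' j, (m j * K j / lam j) *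
      ((1 - Real.exp (-lam j * s)) / (1 + Real.exp (-lam j * s)))) :
    ∃ ω > (0 : ℝ), ∃ σ > (0 : ℝ), ∃ sfun : ℝ → ℝ,
      (∀ b ∈ Set.Ioc (0 : ℝ) ω,
        sfun b ∈ Set.Ioc (0 : ℝ) σ ∧ F (sfun b) = b ∧
          ∀ s' ∈ Set.Ioc (0 : ℝ) σ, F s' = b → s' = sfun b) ∧
      StrictMonoOn sfun (Set.Ioc (0 : ℝ) ω) ∧
      Tendsto sfun (𝓝[>] 0) (𝓝 0) := by
  obtain ⟨G, hGc, hG0, hG⟩ :=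
    hasDerivAt_tsum_one_sub_exp_div_one_add_exp (a := fun j => m j * K j) hpos hsum'
  have hder : ∀ s, HasDerivAt F (m₀K₀ + 2 * G s) s := by
    intro s
    rw [funext hF]
    exact (((hasDerivAt_id s).const_mul m₀K₀).add ((hG s).const_mul 2)).congr_deriv (by simp)
  have hF0 : F 0 = 0 := by simp [hF]
  have hcont : Continuous fun s => m₀K₀ + 2 * G s := by fun_prop
  have hev : ∀ᶠ s in 𝓝 (0 : ℝ), 0 < m₀K₀ + 2 * G s :=
    hcont.continuousAt.eventually (lt_mem_nhds (by dsimp only; rw [hG0]; linarith))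
  obtain ⟨δ, hδ, hball⟩ := Metric.eventually_nhds_iff.1 hev
  have hFc : ContinuousOn F (Set.Icc 0 (δ / 2)) :=
    fun s _ => (hder s).continuousAt.continuousWithinAt
  have hFmono : StrictMonoOn F (Set.Icc 0 (δ / 2)) := by
    refine strictMonoOn_of_deriv_pos (convex_Icc _ _) hFc fun s hs => ?_
    rw [interior_Icc] at hs
    rw [(hder s).deriv]
    refine hball ?_
    rw [Real.dist_eq, sub_zero, abs_of_pos hs.1]
    linarith [hs.2]
  obtain ⟨ω, hω, g, hg⟩ :=
    exists_strictMonoOn_rightInverse_tendsto_zero (half_pos hδ) hFmono hFc hF0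
  exact ⟨ω, hω, δ / 2, half_pos hδ, g, hg⟩
end

section
/- Assume ∑_{j≥1} |m_j K_j| < ∞, the λ_j are positive, strictly increasing with λ_j → ∞, and M = m₀K₀ + ∑_{j≥1} m_j K_j > 0. Then there exists σ > 0 such that for every s ∈ (0, σ] and every t ∈ [0, s], one has m₀K₀ + ∑_{j≥1} m_j K_j · 2 e^{−λ_j t}/(1 + e^{−λ_j s}) > M/2. (This expresses that the mean temperature along the candidate periodic trajectory is strictly increasing up to the first switching moment when the half-period is small.) -/
open Filter Topology

/-- For `0 ≤ t ≤ s` and `0 ≤ l`, the factor `2 exp (-l t) / (1 + exp (-l s))` differs from `1`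
by at most `1 - exp (-l s)`. -/
theorem abs_two_mul_exp_div_sub_one_le {l s t : ℝ} (hl : 0 ≤ l) (ht : 0 ≤ t) (hts : t ≤ s) :
    |2 * Real.exp (-l * t) / (1 + Real.exp (-l * s)) - 1| ≤ 1 - Real.exp (-l * s) := by
  have hs : 0 < Real.exp (-l * s) := Real.exp_pos _
  have hst : Real.exp (-l * s) ≤ Real.exp (-l * t) := Real.exp_le_exp.2 (by nlinarith)
  have ht1 : Real.exp (-l * t) ≤ 1 := Real.exp_le_one_iff.2 (by nlinarith)
  rw [div_sub_one (by positivity), abs_div, abs_of_pos (by positivity : 0 < 1 + Real.exp (-l * s)),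
    div_le_iff₀ (by positivity), abs_le]
  constructor <;> nlinarith

/-- If `a` is absolutely summable and `lam` is nonnegative, then `∑ |aⱼ| (1 - exp (-lamⱼ s))`
tends to `0` as `s` decreases to `0`. -/
theorem tendsto_tsum_abs_mul_one_sub_exp {a lam : ℕ → ℝ} (ha : Summable fun j => |a j|)
    (hlam : ∀ j, 0 ≤ lam j) :
    Tendsto (fun s : ℝ => ∑' j, |a j| * (1 - Real.exp (-lam j * s))) (𝓝[>] 0) (𝓝 0) := by
  have h : Tendsto (fun s : ℝ => ∑' j, |a j| * (1 - Real.exp (-lam j * s))) (𝓝[>] 0)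
      (𝓝 (∑' _ : ℕ, (0 : ℝ))) := by
    refine tendsto_tsum_of_dominated_convergence ha (fun j => ?_) ?_
    · have hc : Continuous fun s : ℝ => |a j| * (1 - Real.exp (-lam j * s)) := by fun_prop
      simpa using (hc.tendsto 0).mono_left nhdsWithin_le_nhds
    · filter_upwards [self_mem_nhdsWithin] with s hs j
      have hs' : 0 < s := hs
      have h1 : Real.exp (-lam j * s) ≤ 1 := Real.exp_le_one_iff.2 (by nlinarith [hlam j])
      rw [Real.norm_eq_abs, abs_mul, abs_abs, abs_of_nonneg (sub_nonneg.2 h1)]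
      exact mul_le_of_le_one_right (abs_nonneg _) (by linarith [Real.exp_pos (-lam j * s)])
  simpa using h

/-- If `M = m₀K₀ + ∑ mⱼ Kⱼ > 0`, then for all sufficiently small half-periods
`s` the derivative of the mean temperature along the candidate periodic
trajectory exceeds `M / 2` on `[0, s]`. -/
theorem mean_temperature_increasing_small_s
    (m₀K₀ : ℝ) (lam m K : ℕ → ℝ)
    (hpos : ∀ j, 0 < lam j) (hmono : StrictMono lam)
    (hinf : Tendsto lam atTop atTop)
    (hsum : Summable fun j => |m j * K j|)
    (hM : 0 < m₀K₀ + ∑' j, m j * K j) :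
    ∃ σ > (0 : ℝ), ∀ s ∈ Set.Ioc (0 : ℝ) σ, ∀ t ∈ Set.Icc (0 : ℝ) s,
      (m₀K₀ + ∑' j, m j * K j *
          (2 * Real.exp (-lam j * t) / (1 + Real.exp (-lam j * s))))
        > (m₀K₀ + ∑' j, m j * K j) / 2 := by
  obtain ⟨σ, hσ, hsub⟩ := mem_nhdsGT_iff_exists_Ioc_subset.1
    ((tendsto_tsum_abs_mul_one_sub_exp hsum fun j => (hpos j).le).eventually_lt_const
      (half_pos hM))
  refine ⟨σ, hσ, fun s hs t ht => ?_⟩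
  have hlt : ∑' j, |m j * K j| * (1 - Real.exp (-lam j * s)) <
      (m₀K₀ + ∑' j, m j * K j) / 2 := hsub hs
  have hfac := fun j => abs_two_mul_exp_div_sub_one_le (hpos j).le ht.1 ht.2
  have hg : Summable fun j => |m j * K j| * (1 - Real.exp (-lam j * s)) :=
    Summable.of_nonneg_of_le
      (fun j => mul_nonneg (abs_nonneg _) ((abs_nonneg _).trans (hfac j)))
      (fun j => mul_le_of_le_one_right (abs_nonneg _)
        (by linarith [Real.exp_pos (-lam j * s)])) hsum
  have hbound : ∀ j, ‖m j * K j *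
      (2 * Real.exp (-lam j * t) / (1 + Real.exp (-lam j * s)) - 1)‖ ≤
      |m j * K j| * (1 - Real.exp (-lam j * s)) := fun j => by
    rw [Real.norm_eq_abs, abs_mul]
    exact mul_le_mul_of_nonneg_left (hfac j) (abs_nonneg _)
  have hd := Summable.of_norm_bounded hg hbound
  have habs := tsum_of_norm_bounded hg.hasSum hbound
  have hsplit : ∑' j, m j * K j * (2 * Real.exp (-lam j * t) / (1 + Real.exp (-lam j * s))) =
      ∑' j, m j * K j + ∑' j, m j * K j *
        (2 * Real.exp (-lam j * t) / (1 + Real.exp (-lam j * s)) - 1) := by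
    rw [← hsum.of_abs.tsum_add hd]
    exact tsum_congr fun j => by ring
  rw [hsplit]
  linarith [(abs_le.1 (Real.norm_eq_abs _ ▸ habs)).1]
end

section
/- If Q(s) ≠ 0, then det(A(s) − I) = (−1)^N (m₀K₀ / Q(s)) ∏_{i=1}^N E_i(s). Equivalently, the eigenvalues μ₁, …, μ_N of A(s) satisfy ∏_{i=1}^N (μ_i − 1) = (−1)^N (m₀K₀ / Q(s)) ∏_{i=1}^N E_i(s). -/
/-- Determinant identity for the linearization matrix `A(s)` of the Poincaré
half-map: if `Q(s) ≠ 0`, then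
`det (A − I) = (−1)^N (m₀K₀ / Q) ∏ᵢ Eᵢ`; equivalently, the eigenvalues μᵢ of
`A` satisfy `∏ᵢ (μᵢ − 1) = (−1)^N (m₀K₀ / Q) ∏ᵢ Eᵢ`. -/
theorem det_A_sub_one
    (N : ℕ) (hN : 1 ≤ N) (m₀K₀ : ℝ) (m K lam : Fin N → ℝ)
    (hlam : ∀ j, 0 < lam j) (s : ℝ) (hs : 0 < s)
    (E Qj : Fin N → ℝ)
    (hE : ∀ j, E j = 1 - Real.exp (-lam j * s))
    (hQj : ∀ j, Qj j =
      2 * Real.exp (-lam j * s) / (1 + Real.exp (-lam j * s)))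
    (Q : ℝ) (hQdef : Q = m₀K₀ + ∑ j, m j * K j * Qj j) (hQ : Q ≠ 0)
    (A : Matrix (Fin N) (Fin N) ℝ)
    (hA : ∀ i j, A i j =
      (if i = j then 1 - E i else 0) + (K i * Qj i / Q) * (m j * E j)) :
    (A - 1).det = (-1) ^ N * (m₀K₀ / Q) * ∏ i, E i := by
  have hfactor : A - 1 =
      (1 + Matrix.replicateCol Unit (fun i => -(K i * Qj i / Q)) * Matrix.replicateRow Unit m) *
        Matrix.diagonal (fun i => -E i) := by
    ext i j
    rw [Matrix.mul_diagonal]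
    simp only [Matrix.sub_apply, Matrix.add_apply, Matrix.one_apply, Matrix.mul_apply, hA,
      Matrix.replicateCol_apply, Matrix.replicateRow_apply, Finset.univ_unique,
      Finset.sum_singleton]
    split_ifs with h
    · subst h
      ring
    · ring
  have hdot : 1 + m ⬝ᵥ (fun i => -(K i * Qj i / Q)) = m₀K₀ / Q := by
    have hsum : m ⬝ᵥ (fun i => -(K i * Qj i / Q)) = -((∑ j, m j * K j * Qj j) / Q) := by
      rw [dotProduct, Finset.sum_div, ← Finset.sum_neg_distrib]
      exact Finset.sum_congr rfl fun j _ => by ring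
    rw [hsum, eq_div_iff hQ, add_mul, neg_mul, div_mul_cancel₀ _ hQ, hQdef]
    ring
  rw [hfactor, Matrix.det_mul, Matrix.det_one_add_replicateCol_mul_replicateRow, hdot,
    Matrix.det_diagonal, Finset.prod_neg, Finset.card_univ, Fintype.card_fin]
  ring
end

section
/- If s > 0, m₀K₀ ≠ 0, and Q(s) ≠ 0, then det(A(s) − I) ≠ 0; that is, 1 is not an eigenvalue of the matrix A(s). (This is assertion 1 of the stability theorem: all eigenvalues μ_i of A satisfy μ_i ≠ 1.) -/
/-- If `s > 0`, `m₀K₀ ≠ 0`, and `Q(s) ≠ 0`, then `det (A(s) − I) ≠ 0`;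
that is, `1` is not an eigenvalue of the matrix `A(s)`. -/
theorem one_not_eigenvalue_of_A
    (N : ℕ) (hN : 1 ≤ N) (m₀K₀ : ℝ) (m K lam : Fin N → ℝ)
    (hlam : ∀ j, 0 < lam j) (s : ℝ) (hs : 0 < s)
    (E Qj : Fin N → ℝ)
    (hE : ∀ j, E j = 1 - Real.exp (-lam j * s))
    (hQj : ∀ j, Qj j =
      2 * Real.exp (-lam j * s) / (1 + Real.exp (-lam j * s)))
    (Q : ℝ) (hQdef : Q = m₀K₀ + ∑ j, m j * K j * Qj j)
    (hm₀K₀ : m₀K₀ ≠ 0) (hQ : Q ≠ 0)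
    (A : Matrix (Fin N) (Fin N) ℝ)
    (hA : ∀ i j, A i j =
      (if i = j then 1 - E i else 0) + (K i * Qj i / Q) * (m j * E j)) :
    (A - 1).det ≠ 0 := by
  intro hdet
  obtain ⟨v, hv, hAv⟩ := Matrix.exists_mulVec_eq_zero_iff.mpr hdet
  have hEpos : ∀ j, E j ≠ 0 := fun j => by
    have : Real.exp (-lam j * s) < 1 :=
      Real.exp_lt_one_iff.mpr (by nlinarith [mul_pos (hlam j) hs])
    rw [hE j]
    linarith
  set t := ∑ j, m j * E j * v j with ht
  have hrow : ∀ i, E i * v i = K i * Qj i / Q * t := fun i => by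
    have h := congrFun hAv i
    have hsum : ((A - 1).mulVec v) i = -(E i * v i) + K i * Qj i / Q * t := by
      have hterm : ∀ j, (A - 1) i j * v j =
          (if i = j then -(E i * v j) else 0) + K i * Qj i / Q * (m j * E j * v j) := fun j => by
        rw [Matrix.sub_apply, hA, Matrix.one_apply]
        split_ifs <;> ring
      simp only [Matrix.mulVec, dotProduct, hterm, Finset.sum_add_distrib, ht, Finset.mul_sum]
      simp
    rw [hsum, Pi.zero_apply] at h
    linarith
  have htt : t = (Q - m₀K₀) / Q * t := by
    have hQ' : Q - m₀K₀ = ∑ j, m j * K j * Qj j := by rw [hQdef]; ring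
    rw [hQ', Finset.sum_div, Finset.sum_mul]
    conv_lhs => rw [ht]
    refine Finset.sum_congr rfl fun j _ => ?_
    rw [mul_assoc, hrow j]
    ring
  have ht0 : t = 0 := by
    have : m₀K₀ * t = 0 := by
      field_simp at htt
      linarith
    exact (mul_eq_zero.mp this).resolve_left hm₀K₀
  refine hv (funext fun i => ?_)
  have h := hrow i
  rw [ht0, mul_zero] at h
  exact (mul_eq_zero.mp h).resolve_left (hEpos i)
end

section
/- Let m₀K₀ > 0, λ₁ > 0, and c ∈ ℝ, and define F₁(s) = m₀K₀ s + (2c/λ₁) · (1 − e^{−λ₁ s})/(1 + e^{−λ₁ s}) for s ≥ 0. Then for every b > 0 there exists exactly one s > 0 with F₁(s) = b. (This is the root-uniqueness part of the corollary asserting that when only the Fourier coefficients m₀ and m₁ are nonzero, the thermocontrol problem has a unique periodic solution for every β − α > 0.) -/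
/-- The function `s ↦ tanh (l * s / 2)`, written with the exponential `exp (-l * s)`. -/
noncomputable def expRatio (l s : ℝ) : ℝ :=
  (1 - Real.exp (-l * s)) / (1 + Real.exp (-l * s))

lemma hasDerivAt_expRatio (l s : ℝ) :
    HasDerivAt (expRatio l)
      (2 * l * (Real.exp (-l * s) / (1 + Real.exp (-l * s)) ^ 2)) s := by
  have he : HasDerivAt (fun x : ℝ => Real.exp (-l * x)) (Real.exp (-l * s) * (-l * 1)) s :=
    ((hasDerivAt_id s).const_mul (-l)).exp
  have hne : 1 + Real.exp (-l * s) ≠ 0 := by positivity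
  refine ((he.const_sub 1).fun_div (he.const_add 1) hne).congr_deriv ?_
  field_simp
  ring

lemma continuous_expRatio (l : ℝ) : Continuous (expRatio l) :=
  continuous_iff_continuousAt.2 fun s => (hasDerivAt_expRatio l s).continuousAt

lemma expRatio_zero (l : ℝ) : expRatio l 0 = 0 := by
  simp [expRatio]

lemma abs_expRatio_le_one (l s : ℝ) : |expRatio l s| ≤ 1 := by
  have he := Real.exp_pos (-l * s)
  have hpos : 0 < 1 + Real.exp (-l * s) := by positivity
  rw [expRatio, abs_le, le_div_iff₀ hpos, div_le_one hpos]
  constructor <;> linarith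

lemma monotone_expRatio {l : ℝ} (hl : 0 ≤ l) : Monotone (expRatio l) :=
  monotone_of_deriv_nonneg (fun s => (hasDerivAt_expRatio l s).differentiableAt) fun s => by
    rw [(hasDerivAt_expRatio l s).deriv]
    positivity

lemma concaveOn_expRatio {l : ℝ} (hl : 0 ≤ l) : ConcaveOn ℝ (Set.Ici 0) (expRatio l) := by
  refine AntitoneOn.concaveOn_of_deriv (convex_Ici 0) (continuous_expRatio l).continuousOn
    (fun s _ => (hasDerivAt_expRatio l s).differentiableAt.differentiableWithinAt) ?_
  intro x hx y hy hxy
  rw [interior_Ici, Set.mem_Ioi] at hx hy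
  rw [(hasDerivAt_expRatio l x).deriv, (hasDerivAt_expRatio l y).deriv]
  refine mul_le_mul_of_nonneg_left ?_ (by positivity)
  have hyx : Real.exp (-l * y) ≤ Real.exp (-l * x) := Real.exp_le_exp.2 (by nlinarith)
  have hx1 : Real.exp (-l * x) ≤ 1 := Real.exp_le_one_iff.2 (by nlinarith)
  have hy0 := Real.exp_pos (-l * y)
  have hx0 := Real.exp_pos (-l * x)
  generalize Real.exp (-l * x) = u at *
  generalize Real.exp (-l * y) = v at *
  rw [div_le_div_iff₀ (by positivity) (by positivity)]
  have huv : u * v ≤ 1 := mul_le_one₀ hx1 hy0.le (hyx.trans hx1)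
  nlinarith [mul_nonneg (sub_nonneg.2 hyx) (sub_nonneg.2 huv)]

lemma mul_expRatio_le_mul_expRatio {l s t : ℝ} (hl : 0 ≤ l) (hs : 0 ≤ s) (hst : s < t) :
    s * expRatio l t ≤ t * expRatio l s := by
  have ht : 0 < t := hs.trans_lt hst
  have h := (concaveOn_expRatio hl).2 (Set.mem_Ici.2 ht.le) (Set.mem_Ici.2 le_rfl)
    (div_nonneg hs ht.le) (sub_nonneg.2 ((div_le_one ht).2 hst.le)) (add_sub_cancel _ _)
  simp only [smul_eq_mul, mul_zero, add_zero, expRatio_zero, div_mul_cancel₀ s ht.ne'] at h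
  rw [div_mul_eq_mul_div, div_le_iff₀ ht] at h
  linarith

lemma exists_pos_mul_add_mul_expRatio_eq {a b : ℝ} (k l : ℝ) (ha : 0 < a) (hb : 0 < b) :
    ∃ s, 0 < s ∧ a * s + k * expRatio l s = b := by
  have hS : 0 ≤ (b + |k|) / a := by positivity
  have hcont : ContinuousOn (fun s => a * s + k * expRatio l s) (Set.Icc 0 ((b + |k|) / a)) :=
    ((continuous_const.mul continuous_id).add
      (continuous_const.mul (continuous_expRatio l))).continuousOn
  have hlower : -|k| ≤ k * expRatio l ((b + |k|) / a) := by
    refine neg_le_of_abs_le ?_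
    rw [abs_mul]
    exact mul_le_of_le_one_right (abs_nonneg k) (abs_expRatio_le_one _ _)
  have hmem : b ∈ Set.Icc (a * 0 + k * expRatio l 0)
      (a * ((b + |k|) / a) + k * expRatio l ((b + |k|) / a)) := by
    rw [expRatio_zero, mul_div_cancel₀ _ ha.ne']
    constructor <;> linarith
  obtain ⟨s, hs, hsb⟩ := intermediate_value_Icc hS hcont hmem
  refine ⟨s, hs.1.lt_of_ne ?_, hsb⟩
  rintro rfl
  simp [expRatio_zero] at hsb
  exact hb.ne hsb

lemma mul_add_mul_expRatio_ne {a b l s t : ℝ} (k : ℝ) (ha : 0 < a) (hb : 0 < b)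
    (hl : 0 ≤ l) (hs : 0 ≤ s) (hst : s < t) (h : a * s + k * expRatio l s = b) :
    a * t + k * expRatio l t ≠ b := by
  intro ht
  rcases le_total 0 k with hk | hk
  · nlinarith [mul_le_mul_of_nonneg_left (monotone_expRatio hl hst.le) hk,
      mul_lt_mul_of_pos_left hst ha]
  · have hle := mul_le_mul_of_nonpos_left (mul_expRatio_le_mul_expRatio hl hs hst) hk
    have htb : t * b ≤ s * b := by
      calc t * b = a * s * t + k * (t * expRatio l s) := by rw [← h]; ring
        _ ≤ a * s * t + k * (s * expRatio l t) := by gcongr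
        _ = s * b := by rw [← ht]; ring
    exact (mul_lt_mul_of_pos_right hst hb).not_ge htb

/-- When only the Fourier coefficients `m₀` and `m₁` are nonzero (case
`N = 1`), the first characteristic equation `F₁ s = b` has exactly one
positive root for every `b > 0`. Here `c` stands for `m₁K₁`. -/
theorem unique_root_N_eq_one
    (m₀K₀ lam₁ c : ℝ) (hm₀K₀ : 0 < m₀K₀) (hlam₁ : 0 < lam₁) :
    ∀ b > (0 : ℝ), ∃! s : ℝ, 0 < s ∧
      m₀K₀ * s + (2 * c / lam₁) *
        ((1 - Real.exp (-lam₁ * s)) / (1 + Real.exp (-lam₁ * s))) = b := by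
  intro b hb
  obtain ⟨s, hs, hsb⟩ := exists_pos_mul_add_mul_expRatio_eq (2 * c / lam₁) lam₁ hm₀K₀ hb
  refine ⟨s, ⟨hs, hsb⟩, ?_⟩
  rintro t ⟨ht, htb⟩
  rcases lt_trichotomy t s with hts | hts | hts
  · exact absurd hsb (mul_add_mul_expRatio_ne _ hm₀K₀ hb hlam₁.le ht.le hts htb)
  · exact hts
  · exact absurd htb (mul_add_mul_expRatio_ne _ hm₀K₀ hb hlam₁.le hs.le hts hsb)
end

section
/- Let λ₁ > 0, m₀K₀ > 0, c ∈ ℝ, and s > 0. Set Q(s) = m₀K₀ + c · 2 e^{−λ₁ s}/(1 + e^{−λ₁ s}) and F₁(s) = m₀K₀ s + (2c/λ₁) · (1 − e^{−λ₁ s})/(1 + e^{−λ₁ s}), and define μ₁ = 1 − (1 − e^{−λ₁ s}) · m₀K₀ / Q(s). If Q(s) > 0 and F₁(s) > 0, then −1 < μ₁ < 1. (This is the eigenvalue bound proving uniform exponential stability of the unique periodic solution in the case N = 1.) -/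
theorem two_mul_mul_exp_neg_le {x : ℝ} (hx : 0 ≤ x) :
    2 * x * Real.exp (-x) ≤ 1 - Real.exp (-x) ^ 2 := by
  have hsinh := Real.self_le_sinh_iff.2 hx
  rw [Real.sinh_eq] at hsinh
  have hexp : Real.exp x * Real.exp (-x) = 1 := by
    rw [← Real.exp_add, add_neg_cancel, Real.exp_zero]
  nlinarith [mul_le_mul_of_nonneg_right hsinh (Real.exp_pos (-x)).le]

/-- Eigenvalue bound in the case `N = 1`: if `Q(s) > 0` and `F₁(s) > 0`,
then the single eigenvalue `μ₁ = 1 − (1 − e^{−λ₁ s}) m₀K₀ / Q(s)` of the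
Poincaré half-map derivative satisfies `−1 < μ₁ < 1`. Here `c` stands for
`m₁K₁`. -/
theorem eigenvalue_bound_N_eq_one
    (lam₁ m₀K₀ c s : ℝ) (hlam₁ : 0 < lam₁) (hm₀K₀ : 0 < m₀K₀) (hs : 0 < s)
    (Q F₁ μ₁ : ℝ)
    (hQ : Q = m₀K₀ + c * (2 * Real.exp (-lam₁ * s) / (1 + Real.exp (-lam₁ * s))))
    (hF₁ : F₁ = m₀K₀ * s + (2 * c / lam₁) *
      ((1 - Real.exp (-lam₁ * s)) / (1 + Real.exp (-lam₁ * s))))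
    (hμ₁ : μ₁ = 1 - (1 - Real.exp (-lam₁ * s)) * m₀K₀ / Q)
    (hQpos : 0 < Q) (hF₁pos : 0 < F₁) :
    -1 < μ₁ ∧ μ₁ < 1 := by
  have hneg : -lam₁ * s = -(lam₁ * s) := by ring
  have hx : 0 < lam₁ * s := mul_pos hlam₁ hs
  have hsinh := two_mul_mul_exp_neg_le hx.le
  have he1 : Real.exp (-(lam₁ * s)) < 1 := Real.exp_lt_one_iff.2 (by linarith)
  have he0 := Real.exp_pos (-(lam₁ * s))
  rw [hneg] at hQ hF₁ hμ₁
  set e := Real.exp (-(lam₁ * s))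
  have hQ' : Q * (1 + e) = m₀K₀ * (1 + e) + 2 * c * e := by
    rw [hQ]; field_simp
  have hF' : F₁ * (lam₁ * (1 + e)) = m₀K₀ * (lam₁ * s) * (1 + e) + 2 * c * (1 - e) := by
    rw [hF₁]; field_simp
  have hFpos : 0 < m₀K₀ * (lam₁ * s) * (1 + e) + 2 * c * (1 - e) := by
    rw [← hF']; positivity
  have hkey : 0 < m₀K₀ * (1 + e) ^ 2 + 4 * c * e := by
    have h₁ : 0 < 2 * e * (m₀K₀ * (lam₁ * s) * (1 + e) + 2 * c * (1 - e)) := by positivity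
    have h₂ : m₀K₀ * (1 + e) * (2 * (lam₁ * s) * e) ≤ m₀K₀ * (1 + e) * (1 - e ^ 2) :=
      mul_le_mul_of_nonneg_left hsinh (by positivity)
    have h₃ : 0 < (1 - e) * (m₀K₀ * (1 + e) ^ 2 + 4 * c * e) := by linarith
    exact pos_of_mul_pos_right h₃ (by linarith)
  have hupper : (1 - e) * m₀K₀ / Q < 2 := by
    rw [div_lt_iff₀ hQpos]
    have h₁ : 0 < (1 + e) * (2 * Q - (1 - e) * m₀K₀) := by linarith
    linarith [pos_of_mul_pos_right h₁ (by linarith)]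
  have hlower : 0 < (1 - e) * m₀K₀ / Q :=
    div_pos (mul_pos (by linarith) hm₀K₀) hQpos
  constructor <;> linarith
end

section
/- Let N = 2, λ₁, λ₂ > 0, and assume M = m₀K₀ + m₁K₁ + m₂K₂ > 0. Then as s → 0⁺: (i) trace(A(s) − I)/s converges to −L, where L = ((M − m₁K₁)λ₁ + (M − m₂K₂)λ₂)/M; and (ii) det(A(s) − I)/s² converges to λ₁λ₂ m₀K₀ / M. (In particular Q(s) → M > 0, so A(s) is defined for all sufficiently small s > 0.) -/
open Filter Topology

/-- The difference quotient at `0` of `s ↦ 1 - exp (-lam * s)` tends to `lam`. -/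
theorem tendsto_one_sub_exp_neg_mul_div (lam : ℝ) :
    Tendsto (fun s : ℝ => (1 - Real.exp (-lam * s)) / s) (𝓝[>] 0) (𝓝 lam) := by
  have hderiv : HasDerivAt (fun s : ℝ => 1 - Real.exp (-lam * s)) lam 0 := by
    simpa using (((hasDerivAt_id (0 : ℝ)).const_mul (-lam)).exp).const_sub 1
  refine (hderiv.tendsto_slope_zero_right).congr fun s => ?_
  simp [div_eq_inv_mul]

/-- The function `s ↦ 2 * exp (-lam * s) / (1 + exp (-lam * s))` tends to `1` at `0`. -/
theorem tendsto_two_mul_exp_div_one_add_exp (lam : ℝ) :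
    Tendsto (fun s : ℝ => 2 * Real.exp (-lam * s) / (1 + Real.exp (-lam * s)))
      (𝓝[>] 0) (𝓝 1) := by
  have hcont : Continuous
      fun s : ℝ => 2 * Real.exp (-lam * s) / (1 + Real.exp (-lam * s)) :=
    Continuous.div (by fun_prop) (by fun_prop) fun s => by positivity
  have hlim := hcont.tendsto 0
  norm_num at hlim
  simpa using hlim.mono_left nhdsWithin_le_nhds

/-- Asymptotics of the linearization matrix `A(s)` in the case `N = 2` as
`s → 0⁺`: `trace (A(s) − I) / s → −L` with
`L = ((M − m₁K₁)λ₁ + (M − m₂K₂)λ₂)/M`, and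
`det (A(s) − I) / s² → λ₁λ₂ m₀K₀ / M`; in particular `Q(s) → M > 0`. -/
theorem trace_det_asymptotics_N_eq_two
    (m₀K₀ m₁ m₂ K₁ K₂ lam₁ lam₂ M : ℝ)
    (hlam₁ : 0 < lam₁) (hlam₂ : 0 < lam₂)
    (hM : M = m₀K₀ + m₁ * K₁ + m₂ * K₂) (hMpos : 0 < M)
    (E₁ E₂ Q₁ Q₂ Q S₁ S₂ : ℝ → ℝ)
    (hE₁ : ∀ s, E₁ s = 1 - Real.exp (-lam₁ * s))
    (hE₂ : ∀ s, E₂ s = 1 - Real.exp (-lam₂ * s))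
    (hQ₁ : ∀ s, Q₁ s = 2 * Real.exp (-lam₁ * s) / (1 + Real.exp (-lam₁ * s)))
    (hQ₂ : ∀ s, Q₂ s = 2 * Real.exp (-lam₂ * s) / (1 + Real.exp (-lam₂ * s)))
    (hQ : ∀ s, Q s = m₀K₀ + m₁ * K₁ * Q₁ s + m₂ * K₂ * Q₂ s)
    (hS₁ : ∀ s, S₁ s = K₁ * Q₁ s / Q s)
    (hS₂ : ∀ s, S₂ s = K₂ * Q₂ s / Q s)
    (A : ℝ → Matrix (Fin 2) (Fin 2) ℝ)
    (hA : ∀ s, A s =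
      !![1 - E₁ s + S₁ s * (m₁ * E₁ s), S₁ s * (m₂ * E₂ s);
         S₂ s * (m₁ * E₁ s), 1 - E₂ s + S₂ s * (m₂ * E₂ s)]) :
    Tendsto Q (𝓝[>] 0) (𝓝 M) ∧
    Tendsto (fun s => Matrix.trace (A s - 1) / s) (𝓝[>] 0)
      (𝓝 (-(((M - m₁ * K₁) * lam₁ + (M - m₂ * K₂) * lam₂) / M))) ∧
    Tendsto (fun s => (A s - 1).det / s ^ 2) (𝓝[>] 0)
      (𝓝 (lam₁ * lam₂ * m₀K₀ / M)) := by
  have hE₁lim : Tendsto (fun s => E₁ s / s) (𝓝[>] 0) (𝓝 lam₁) := by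
    simpa only [hE₁] using tendsto_one_sub_exp_neg_mul_div lam₁
  have hE₂lim : Tendsto (fun s => E₂ s / s) (𝓝[>] 0) (𝓝 lam₂) := by
    simpa only [hE₂] using tendsto_one_sub_exp_neg_mul_div lam₂
  have hQ₁lim : Tendsto Q₁ (𝓝[>] 0) (𝓝 1) := by
    rw [funext hQ₁]; exact tendsto_two_mul_exp_div_one_add_exp lam₁
  have hQ₂lim : Tendsto Q₂ (𝓝[>] 0) (𝓝 1) := by
    rw [funext hQ₂]; exact tendsto_two_mul_exp_div_one_add_exp lam₂
  have hQlim : Tendsto Q (𝓝[>] 0) (𝓝 M) := by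
    rw [funext hQ, hM]
    simpa using ((hQ₁lim.const_mul (m₁ * K₁)).const_add m₀K₀).add
      (hQ₂lim.const_mul (m₂ * K₂))
  have hS₁lim : Tendsto S₁ (𝓝[>] 0) (𝓝 (K₁ / M)) := by
    rw [funext hS₁]
    simpa only [mul_one] using! (hQ₁lim.const_mul K₁).div hQlim hMpos.ne'
  have hS₂lim : Tendsto S₂ (𝓝[>] 0) (𝓝 (K₂ / M)) := by
    rw [funext hS₂]
    simpa only [mul_one] using! (hQ₂lim.const_mul K₂).div hQlim hMpos.ne'
  refine ⟨hQlim, ?_, ?_⟩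
  · have hlim := (((hS₁lim.const_mul m₁).sub_const 1).mul hE₁lim).add
      (((hS₂lim.const_mul m₂).sub_const 1).mul hE₂lim)
    convert hlim using 2 with s
    · simp only [hA, Matrix.trace_fin_two, Matrix.sub_apply, Matrix.of_apply, Matrix.cons_val',
        Matrix.cons_val_zero, Matrix.cons_val_one, Matrix.cons_val_fin_one, Matrix.one_apply_eq]
      ring
    · field_simp
      ring
  · have hlim := (hE₁lim.mul hE₂lim).mul
      (((hS₁lim.const_mul m₁).add (hS₂lim.const_mul m₂)).const_sub 1)
    convert hlim using 2 with s
    · simp only [hA, Matrix.det_fin_two, Matrix.sub_apply, Matrix.of_apply, Matrix.cons_val',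
        Matrix.cons_val_zero, Matrix.cons_val_one, Matrix.cons_val_fin_one, Matrix.one_apply_eq,
        Matrix.one_apply_ne (zero_ne_one' (Fin 2)), Matrix.one_apply_ne (one_ne_zero' (Fin 2))]
      ring
    · field_simp
      rw [hM]
      ring
end

section
/- Let N ≥ 3, λ₁, …, λ_N > 0, and assume M = m₀K₀ + ∑_{j=1}^N m_jK_j > 0 and ∑_{j=1}^N (M − m_jK_j) λ_j < 0. Then there exists s₀ > 0 such that for every s ∈ (0, s₀) one has trace A(s) > N; consequently, for every such s the matrix A(s) has a complex eigenvalue μ with Re μ > 1. (This yields instability of the symmetric 2s-periodic solution for all sufficiently small β − α.) -/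
open Filter Topology

/-- A complex square matrix whose trace has real part larger than its size has a spectral value
of real part larger than `1`. -/
theorem exists_mem_spectrum_one_lt_re {n : Type*} [Fintype n] [DecidableEq n]
    (B : Matrix n n ℂ) (h : (Fintype.card n : ℝ) < B.trace.re) :
    ∃ μ ∈ spectrum ℂ B, 1 < μ.re := by
  by_contra! hc
  have hcard : B.charpoly.roots.card = Fintype.card n := by
    rw [← (IsAlgClosed.splits B.charpoly).natDegree_eq_card_roots,
      Matrix.charpoly_natDegree_eq_dim]
  have hsum : B.trace.re = (B.charpoly.roots.map Complex.re).sum := by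
    rw [Matrix.trace_eq_sum_roots_charpoly B]
    exact map_multiset_sum Complex.reAddGroupHom _
  have hle : (B.charpoly.roots.map Complex.re).sum ≤
      (B.charpoly.roots.map Complex.re).card • (1 : ℝ) := by
    refine Multiset.sum_le_card_nsmul _ _ fun x hx => ?_
    obtain ⟨μ, hμ, rfl⟩ := Multiset.mem_map.1 hx
    exact hc μ (Matrix.mem_spectrum_iff_isRoot_charpoly.2 (Polynomial.isRoot_of_mem_roots hμ))
  rw [Multiset.card_map, hcard, nsmul_eq_mul, mul_one] at hle
  linarith

theorem tendsto_one_sub_exp_div_nhdsGT_zero (a : ℝ) :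
    Tendsto (fun s => (1 - Real.exp (-a * s)) / s) (𝓝[>] 0) (𝓝 a) := by
  have hd : HasDerivAt (fun s : ℝ => 1 - Real.exp (-a * s)) a 0 := by
    have h := (((hasDerivAt_id (0 : ℝ)).const_mul (-a)).exp).const_sub 1
    simpa using h
  have h := hd.tendsto_slope_zero_right
  simpa [div_eq_inv_mul] using h

/-- Instability for `N ≥ 3`: if `M = m₀K₀ + ∑ mⱼKⱼ > 0` and
`∑ⱼ (M − mⱼKⱼ) λⱼ < 0`, then for all sufficiently small `s > 0` one has
`trace A(s) > N`; consequently `A(s)` has a complex eigenvalue `μ` with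
`Re μ > 1`. -/
theorem instability_N_ge_three
    (N : ℕ) (hN : 3 ≤ N) (m₀K₀ M : ℝ) (m K lam : Fin N → ℝ)
    (hlam : ∀ j, 0 < lam j)
    (hM : M = m₀K₀ + ∑ j, m j * K j) (hMpos : 0 < M)
    (hL : ∑ j, (M - m j * K j) * lam j < 0)
    (E Qj : Fin N → ℝ → ℝ) (Q : ℝ → ℝ)
    (hE : ∀ j s, E j s = 1 - Real.exp (-lam j * s))
    (hQj : ∀ j s, Qj j s =
      2 * Real.exp (-lam j * s) / (1 + Real.exp (-lam j * s)))
    (hQ : ∀ s, Q s = m₀K₀ + ∑ j, m j * K j * Qj j s)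
    (A : ℝ → Matrix (Fin N) (Fin N) ℝ)
    (hA : ∀ s i j, A s i j =
      (if i = j then 1 - E i s else 0) +
        (K i * Qj i s / Q s) * (m j * E j s)) :
    ∃ s₀ > (0 : ℝ), ∀ s ∈ Set.Ioo (0 : ℝ) s₀,
      (N : ℝ) < Matrix.trace (A s) ∧
      ∃ μ ∈ spectrum ℂ ((A s).map (Complex.ofReal ·)), 1 < μ.re := by
  have hQj_lim (j) : Tendsto (Qj j) (𝓝[>] 0) (𝓝 1) := by
    have hc : Continuous (Qj j) := by
      rw [funext (hQj j)]
      exact Continuous.div (by fun_prop) (by fun_prop) fun s => by positivity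
    have h := hc.tendsto 0
    have h1 : Qj j 0 = 1 := by rw [hQj]; norm_num
    rw [h1] at h
    exact h.mono_left nhdsWithin_le_nhds
  have hQ_lim : Tendsto Q (𝓝[>] 0) (𝓝 M) := by
    have h : Tendsto (fun s => m₀K₀ + ∑ j, m j * K j * Qj j s) (𝓝[>] 0)
        (𝓝 (m₀K₀ + ∑ j, m j * K j * 1)) :=
      tendsto_const_nhds.add (tendsto_finsetSum _ fun j _ => (hQj_lim j).const_mul _)
    rw [funext hQ, hM]
    simpa using h
  have hE_lim (j) : Tendsto (fun s => E j s / s) (𝓝[>] 0) (𝓝 (lam j)) := by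
    simpa only [hE] using tendsto_one_sub_exp_div_nhdsGT_zero (lam j)
  have hlim : Tendsto (fun s => ∑ j, (m j * K j * Qj j s / Q s - 1) * (E j s / s)) (𝓝[>] 0)
      (𝓝 (∑ j, (m j * K j * 1 / M - 1) * lam j)) :=
    tendsto_finsetSum _ fun j _ =>
      ((((hQj_lim j).const_mul _).div hQ_lim hMpos.ne').sub_const 1).mul (hE_lim j)
  have hpos : 0 < ∑ j, (m j * K j * 1 / M - 1) * lam j := by
    have h : ∑ j, (m j * K j * 1 / M - 1) * lam j = -(∑ j, (M - m j * K j) * lam j) / M := by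
      rw [← Finset.sum_neg_distrib, Finset.sum_div]
      refine Finset.sum_congr rfl fun j _ => ?_
      field_simp
      ring
    rw [h]
    exact div_pos (neg_pos.2 hL) hMpos
  obtain ⟨s₀, hs₀, hsub⟩ := mem_nhdsGT_iff_exists_Ioo_subset.1 (hlim.eventually_const_lt hpos)
  refine ⟨s₀, hs₀, fun s hs => ?_⟩
  have hsum : 0 < ∑ j, (m j * K j * Qj j s / Q s - 1) * (E j s / s) := hsub hs
  have htrace : (A s).trace = N + s * ∑ j, (m j * K j * Qj j s / Q s - 1) * (E j s / s) := by
    have hN' : (N : ℝ) = ∑ _j : Fin N, (1 : ℝ) := by simp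
    rw [hN', Finset.mul_sum, ← Finset.sum_add_distrib, Matrix.trace]
    refine Finset.sum_congr rfl fun j _ => ?_
    have hs' : s * (E j s / s) = E j s := mul_div_cancel₀ _ hs.1.ne'
    rw [Matrix.diag_apply, hA, if_pos rfl, mul_left_comm s, hs']
    ring
  have hlt : (N : ℝ) < (A s).trace := by
    rw [htrace]
    exact lt_add_of_pos_right _ (mul_pos hs.1 hsum)
  refine ⟨hlt, exists_mem_spectrum_one_lt_re _ ?_⟩
  simpa [Matrix.trace] using hlt
end
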